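/- Let λ > 0 and let ρ, J, S, φ : ℝ × ℝ → ℝ be sufficiently smooth (say four times continuously differentiable) functions of (x,t) satisfying, for all x ∈ ℝ and all t ≥ 0: (i) the continuity equation ∂_t ρ + ∂_x J = 0; (ii) the momentum equation ∂_t J + ∂_x S = ρ ∂_x φ; (iii) the reformulated Poisson equation λ² ∂_{tt} ∂_{xx} φ + ∂_x(ρ ∂_x φ) = ∂_{xx} S. Then for all x ∈ ℝ and t ≥ 0 one has ρ(x,t) − 1 = λ² ∂_{xx} φ(x,t) + (ρ(x,0) − 1 − λ² ∂_{xx} φ(x,0)) − t · (∂_x J(x,0) + λ² ∂_t ∂_{xx} φ(x,0)). -/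

import Mathlib

/-- Spatial partial derivative of a function of `(x, t)`. -/
noncomputable def pdx (f : ℝ × ℝ → ℝ) (x t : ℝ) : ℝ := deriv (fun y => f (y, t)) x

/-- Temporal partial derivative of a function of `(x, t)`. -/
noncomputable def pdt (f : ℝ × ℝ → ℝ) (x t : ℝ) : ℝ := deriv (fun s => f (x, s)) t

/-- Second spatial partial derivative of a function of `(x, t)`. -/
noncomputable def pdxx (f : ℝ × ℝ → ℝ) (x t : ℝ) : ℝ := deriv (fun y => pdx f y t) x

/-- `∂_t ∂_{xx}` of a function of `(x, t)`. -/
noncomputable def pdtxx (f : ℝ × ℝ → ℝ) (x t : ℝ) : ℝ := deriv (fun s => pdxx f x s) t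

/-- `∂_{tt} ∂_{xx}` of a function of `(x, t)`. -/
noncomputable def pdttxx (f : ℝ × ℝ → ℝ) (x t : ℝ) : ℝ := deriv (fun s => pdtxx f x s) t

theorem pdx_eq_fderiv {f : ℝ × ℝ → ℝ} (hf : Differentiable ℝ f) (x t : ℝ) :
    pdx f x t = fderiv ℝ f (x, t) (1, 0) := by
  have h := (hf (x, t)).hasFDerivAt.comp_hasDerivAt x
    ((hasDerivAt_id x).prodMk (hasDerivAt_const x t))
  exact h.deriv

theorem pdt_eq_fderiv {f : ℝ × ℝ → ℝ} (hf : Differentiable ℝ f) (x t : ℝ) :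
    pdt f x t = fderiv ℝ f (x, t) (0, 1) := by
  have h := (hf (x, t)).hasFDerivAt.comp_hasDerivAt t
    ((hasDerivAt_const t x).prodMk (hasDerivAt_id t))
  exact h.deriv

theorem contDiff_pdx {f : ℝ × ℝ → ℝ} {m n : WithTop ℕ∞} (hf : ContDiff ℝ n f)
    (hmn : m + 1 ≤ n) : ContDiff ℝ m (fun p : ℝ × ℝ => pdx f p.1 p.2) := by
  have hd : Differentiable ℝ f := (hf.of_le (le_trans le_add_self hmn)).differentiable one_ne_zero
  simp only [pdx_eq_fderiv hd]
  exact (hf.fderiv_right hmn).clm_apply contDiff_const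

theorem contDiff_pdt {f : ℝ × ℝ → ℝ} {m n : WithTop ℕ∞} (hf : ContDiff ℝ n f)
    (hmn : m + 1 ≤ n) : ContDiff ℝ m (fun p : ℝ × ℝ => pdt f p.1 p.2) := by
  have hd : Differentiable ℝ f := (hf.of_le (le_trans le_add_self hmn)).differentiable one_ne_zero
  simp only [pdt_eq_fderiv hd]
  exact (hf.fderiv_right hmn).clm_apply contDiff_const

theorem hasDerivAt_pdx {f : ℝ × ℝ → ℝ} (hf : Differentiable ℝ f) (x t : ℝ) :
    HasDerivAt (fun y => f (y, t)) (pdx f x t) x :=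
  (hf.comp (differentiable_id.prodMk (differentiable_const t)) x).hasDerivAt

theorem hasDerivAt_pdt {f : ℝ × ℝ → ℝ} (hf : Differentiable ℝ f) (x t : ℝ) :
    HasDerivAt (fun s => f (x, s)) (pdt f x t) t :=
  (hf.comp ((differentiable_const x).prodMk differentiable_id) t).hasDerivAt

/-- Mixed partial derivatives of a `C²` function commute. -/
theorem pdt_pdx_comm {f : ℝ × ℝ → ℝ} (hf : ContDiff ℝ 2 f) (x t : ℝ) :
    pdt (fun p => pdx f p.1 p.2) x t = pdx (fun p => pdt f p.1 p.2) x t := by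
  have hd : Differentiable ℝ f := hf.differentiable two_ne_zero
  have h2 : (1 : WithTop ℕ∞) + 1 ≤ 2 := by norm_num
  have hd' : Differentiable ℝ (fderiv ℝ f) := (hf.fderiv_right h2).differentiable one_ne_zero
  rw [pdt_eq_fderiv ((contDiff_pdx hf h2).differentiable one_ne_zero),
    pdx_eq_fderiv ((contDiff_pdt hf h2).differentiable one_ne_zero)]
  simp only [pdx_eq_fderiv hd, pdt_eq_fderiv hd]
  rw [fderiv_clm_apply (hd' _) (differentiableAt_const _),
    fderiv_clm_apply (hd' _) (differentiableAt_const _)]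
  have hsymm : IsSymmSndFDerivAt ℝ f (x, t) :=
    hf.contDiffAt.isSymmSndFDerivAt (by simp)
  simpa using hsymm.eq (0, 1) (1, 0)

theorem eq_of_hasDerivAt_zero_of_nonneg {f : ℝ → ℝ} (hf : ∀ t, 0 ≤ t → HasDerivAt f 0 t)
    {t : ℝ} (ht : 0 ≤ t) : f t = f 0 :=
  constant_of_has_deriv_right_zero
    (fun s hs => (hf s hs.1).continuousAt.continuousWithinAt)
    (fun s hs => (hf s hs.1).hasDerivWithinAt) t ⟨ht, le_rfl⟩

/-- The explicit identity derived in the proof of Lemma 2.2. -/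
theorem density_identity_RVP
    (lam : ℝ) (hlam : 0 < lam)
    (ρ J S φ : ℝ × ℝ → ℝ)
    (hρ : ContDiff ℝ 4 ρ) (hJ : ContDiff ℝ 4 J) (hS : ContDiff ℝ 4 S)
    (hφ : ContDiff ℝ 4 φ)
    (hcont : ∀ x t : ℝ, 0 ≤ t → pdt ρ x t + pdx J x t = 0)
    (hmom : ∀ x t : ℝ, 0 ≤ t → pdt J x t + pdx S x t = ρ (x, t) * pdx φ x t)
    (hrpe : ∀ x t : ℝ, 0 ≤ t →
      lam ^ 2 * pdttxx φ x t + pdx (fun p => ρ p * pdx φ p.1 p.2) x t = pdxx S x t) :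
    ∀ x t : ℝ, 0 ≤ t →
      ρ (x, t) - 1 =
        lam ^ 2 * pdxx φ x t + (ρ (x, 0) - 1 - lam ^ 2 * pdxx φ x 0) -
          t * (pdx J x 0 + lam ^ 2 * pdtxx φ x 0) := by
  intro x t ht
  have hφ1 : ContDiff ℝ 3 (fun p : ℝ × ℝ => pdx φ p.1 p.2) := contDiff_pdx hφ (by norm_num)
  have hφ2 : ContDiff ℝ 2 (fun p : ℝ × ℝ => pdxx φ p.1 p.2) := contDiff_pdx hφ1 (by norm_num)
  have hφ3 : ContDiff ℝ 1 (fun p : ℝ × ℝ => pdtxx φ p.1 p.2) := contDiff_pdt hφ2 (by norm_num)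
  have hJx : ContDiff ℝ 3 (fun p : ℝ × ℝ => pdx J p.1 p.2) := contDiff_pdx hJ (by norm_num)
  have hJt : ContDiff ℝ 3 (fun p : ℝ × ℝ => pdt J p.1 p.2) := contDiff_pdt hJ (by norm_num)
  have hSx : ContDiff ℝ 3 (fun p : ℝ × ℝ => pdx S p.1 p.2) := contDiff_pdx hS (by norm_num)
  have hflux : ∀ s, 0 ≤ s → HasDerivAt (fun s => pdx J x s + lam ^ 2 * pdtxx φ x s) 0 s := by
    intro s hs
    have hadd := (hasDerivAt_pdt (hJx.differentiable (by norm_num)) x s).add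
      ((hasDerivAt_pdt (hφ3.differentiable one_ne_zero) x s).const_mul (lam ^ 2))
    have hmomx : pdx (fun p => pdt J p.1 p.2) x s + pdxx S x s =
        pdx (fun p => ρ p * pdx φ p.1 p.2) x s := by
      have hsum := (hasDerivAt_pdx (hJt.differentiable (by norm_num)) x s).add
        (hasDerivAt_pdx (hSx.differentiable (by norm_num)) x s)
      refine hsum.deriv.symm.trans ?_
      exact congrArg (deriv · x) (funext fun y => hmom y s hs)
    refine hadd.congr_deriv ?_
    rw [pdt_pdx_comm (hJ.of_le (by norm_num))]
    have hpoisson := hrpe x s hs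
    change _ + lam ^ 2 * pdttxx φ x s = 0
    linarith
  have hdensity : ∀ s, 0 ≤ s → HasDerivAt (fun s => ρ (x, s) - lam ^ 2 * pdxx φ x s +
      s * (pdx J x 0 + lam ^ 2 * pdtxx φ x 0)) 0 s := by
    intro s hs
    have hadd := ((hasDerivAt_pdt (hρ.differentiable (by norm_num)) x s).sub
      ((hasDerivAt_pdt (hφ2.differentiable two_ne_zero) x s).const_mul (lam ^ 2))).add
      ((hasDerivAt_id s).mul_const (pdx J x 0 + lam ^ 2 * pdtxx φ x 0))
    refine hadd.congr_deriv ?_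
    have hconst := eq_of_hasDerivAt_zero_of_nonneg hflux hs
    have hc := hcont x s hs
    change pdt ρ x s - lam ^ 2 * pdtxx φ x s + _ = 0
    linarith
  have hfinal := eq_of_hasDerivAt_zero_of_nonneg hdensity ht
  linarith
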